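/- With G = (X, Y) as defined below (the offset of the place (h^p, β·h^{2p} + ξ·h^r) with 2p < r < 3p, under the degeneracy condition 2·ε·d·β·cos θ = 1), the signature of G at 0 is (p, r − p): the least integer n ≥ 1 with G⁽ⁿ⁾(0) ≠ 0 is n = p, with G⁽ᵖ⁾(0) = p!·(0, −2εdβ sin θ) ≠ 0; G⁽ᵐ⁾(0) = 0 for p < m < r − p; and G^{(r−p)}(0) has first component (r−p)!·(−ε·d·r·ξ·cos θ/p) ≠ 0, so it is linearly independent from G⁽ᵖ⁾(0). Consequently, in this case the local shape of the place is preserved if and only if p and r are both even or both odd. -/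

import Mathlib

/-- The speed factor `s(h) = √(p² + (2pβ·h^p + rξ·h^{r−p})²)` of the place
`(h^p, β·h^{2p} + ξ·h^r)` divided by `h^{p−1}`; it is everywhere positive. -/
noncomputable def offSpeed2 (p r : ℕ) (β ξ : ℝ) (h : ℝ) : ℝ :=
  Real.sqrt ((p : ℝ) ^ 2 + (2 * (p : ℝ) * β * h ^ p + (r : ℝ) * ξ * h ^ (r - p)) ^ 2)

/-- First coordinate of the generalized offset place of `(h^p, β·h^{2p} + ξ·h^r)`
at distance `d` and angle `θ`, with sign `ε`. -/
noncomputable def offX2 (p r : ℕ) (β ξ d θ ε : ℝ) (h : ℝ) : ℝ :=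
  h ^ p + ε * d * (-(2 * (p : ℝ) * β * h ^ p + (r : ℝ) * ξ * h ^ (r - p)) * Real.cos θ
      - (p : ℝ) * Real.sin θ) / offSpeed2 p r β ξ h

/-- Second coordinate of the generalized offset place of `(h^p, β·h^{2p} + ξ·h^r)`
at distance `d` and angle `θ`, with sign `ε`. -/
noncomputable def offY2 (p r : ℕ) (β ξ d θ ε : ℝ) (h : ℝ) : ℝ :=
  β * h ^ (2 * p) + ξ * h ^ r
    + ε * d * (-(2 * (p : ℝ) * β * h ^ p + (r : ℝ) * ξ * h ^ (r - p)) * Real.sin θ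
        + (p : ℝ) * Real.cos θ) / offSpeed2 p r β ξ h

/-- The generalized offset place `G = (X, Y)` of the place `(h^p, β·h^{2p} + ξ·h^r)`. -/
noncomputable def offG2 (p r : ℕ) (β ξ d θ ε : ℝ) (h : ℝ) : ℝ × ℝ :=
  (offX2 p r β ξ d θ ε h, offY2 p r β ξ d θ ε h)

open scoped ContDiff in
/-- A smooth function times `x ^ k` has vanishing derivatives at `0` below order `k`. -/
theorem iteratedDeriv_pow_smul_zero_of_lt {E : Type*} [NormedAddCommGroup E] [NormedSpace ℝ E]
    {F : ℝ → E} (hF : ContDiff ℝ ∞ F) {n k : ℕ} (hnk : n < k) :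
    iteratedDeriv n (fun x : ℝ => x ^ k • F x) 0 = 0 := by
  have hn : ContDiff ℝ n F := hF.of_le (by exact_mod_cast le_top)
  have hk : ContDiff ℝ n (fun x : ℝ => x ^ k) := by fun_prop
  have h := iteratedDerivWithin_smul (Set.mem_univ (0 : ℝ)) uniqueDiffOn_univ
    hk.contDiffAt.contDiffWithinAt hn.contDiffAt.contDiffWithinAt
  simp only [iteratedDerivWithin_univ] at h
  refine h.trans (Finset.sum_eq_zero fun i hi => ?_)
  have hik : i ≠ k := by
    have := Finset.mem_range.1 hi
    omega
  rw [iteratedDeriv_fun_pow_zero, if_neg hik, Nat.cast_zero, zero_smul, smul_zero]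

theorem iteratedDeriv_pow_smul_const_zero {E : Type*} [NormedAddCommGroup E] [NormedSpace ℝ E]
    (n k : ℕ) (v : E) :
    iteratedDeriv n (fun x : ℝ => x ^ k • v) 0 = if n = k then (k.factorial : ℝ) • v else 0 := by
  have hk : ContDiff ℝ n (fun x : ℝ => x ^ k) := by fun_prop
  have h := iteratedDerivWithin_smul_const (Set.mem_univ (0 : ℝ)) uniqueDiffOn_univ
    hk.contDiffAt.contDiffWithinAt v
  simp only [iteratedDerivWithin_univ] at h
  rw [h, iteratedDeriv_fun_pow_zero]
  split_ifs <;> simp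

open scoped ContDiff in
/-- Derivatives at `0`, of positive order below `l`, of a function with Taylor expansion
`c + x ^ p • a + x ^ q • b + O(x ^ l)`. -/
theorem iteratedDeriv_zero_of_two_term_expansion {E : Type*} [NormedAddCommGroup E]
    [NormedSpace ℝ E] {F : ℝ → E} (hF : ContDiff ℝ ∞ F) (a b c : E) {n l : ℕ} (p q : ℕ)
    (hn : 0 < n) (hnl : n < l) :
    iteratedDeriv n (fun x : ℝ => c + (x ^ p • a + (x ^ q • b + x ^ l • F x))) 0
      = (if n = p then (p.factorial : ℝ) • a else 0)
        + (if n = q then (q.factorial : ℝ) • b else 0) := by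
  have hF' : ContDiff ℝ n F := hF.of_le (by exact_mod_cast le_top)
  have hp : ContDiff ℝ n (fun x : ℝ => x ^ p • a) := by fun_prop
  have hq : ContDiff ℝ n (fun x : ℝ => x ^ q • b) := by fun_prop
  have hl : ContDiff ℝ n (fun x : ℝ => x ^ l • F x) := by fun_prop
  rw [iteratedDeriv_const_add hn,
    iteratedDeriv_fun_add hp.contDiffAt (hq.add hl).contDiffAt,
    iteratedDeriv_fun_add hq.contDiffAt hl.contDiffAt,
    iteratedDeriv_pow_smul_const_zero, iteratedDeriv_pow_smul_const_zero,
    iteratedDeriv_pow_smul_zero_of_lt hF hnl, add_zero]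

theorem offSpeed2_pos {p : ℕ} (hp : 0 < p) (r : ℕ) (β ξ h : ℝ) : 0 < offSpeed2 p r β ξ h :=
  Real.sqrt_pos.2 (by positivity)

open scoped ContDiff in
theorem contDiff_offSpeed2 {p : ℕ} (hp : 0 < p) (r : ℕ) (β ξ : ℝ) :
    ContDiff ℝ ∞ (offSpeed2 p r β ξ) :=
  ContDiff.sqrt (by fun_prop) fun x => by positivity

open scoped ContDiff in
theorem exists_inv_offSpeed2_eq {p r : ℕ} (hp : 0 < p) (hr : 2 * p ≤ r) (β ξ : ℝ) :
    ∃ K : ℝ → ℝ, ContDiff ℝ ∞ K ∧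
      ∀ h, (offSpeed2 p r β ξ h)⁻¹ = (p : ℝ)⁻¹ + h ^ (2 * p) * K h := by
  have hs := offSpeed2_pos hp r β ξ
  have hs' := contDiff_offSpeed2 hp r β ξ
  have hp0 : (0 : ℝ) < p := by exact_mod_cast hp
  refine ⟨fun h => -(2 * p * β + r * ξ * h ^ (r - 2 * p)) ^ 2
      / (p * offSpeed2 p r β ξ h * (p + offSpeed2 p r β ξ h)), ?_, fun h => ?_⟩
  · refine ContDiff.div (by fun_prop) (by fun_prop) fun h => ?_
    have := hs h
    positivity
  · have hsq : offSpeed2 p r β ξ h ^ 2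
        = p ^ 2 + h ^ (2 * p) * (2 * p * β + r * ξ * h ^ (r - 2 * p)) ^ 2 := by
      rw [offSpeed2, Real.sq_sqrt (by positivity), show r - p = p + (r - 2 * p) by omega]
      ring
    have := hs h
    field_simp
    linear_combination -hsq

open scoped ContDiff in
/-- The Taylor expansion at `0` of the offset place, up to order `2 * p`. -/
theorem exists_offG2_eq {p r : ℕ} (hp : 0 < p) (hr : 2 * p ≤ r) (β ξ d θ ε : ℝ)
    (hdeg : 2 * ε * d * β * Real.cos θ = 1) :
    ∃ F : ℝ → ℝ × ℝ, ContDiff ℝ ∞ F ∧ offG2 p r β ξ d θ ε = fun h =>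
      (-(ε * d * Real.sin θ), ε * d * Real.cos θ)
        + (h ^ p • ((0 : ℝ), -(2 * ε * d * β * Real.sin θ))
        + (h ^ (r - p) • (-(ε * d * r * ξ * Real.cos θ / p), -(ε * d * r * ξ * Real.sin θ / p))
        + h ^ (2 * p) • F h)) := by
  obtain ⟨K, hK, hKs⟩ := exists_inv_offSpeed2_eq hp hr β ξ
  have hp0 : (p : ℝ) ≠ 0 := by exact_mod_cast hp.ne'
  refine ⟨fun h => (ε * d * (-(2 * p * β * h ^ p + r * ξ * h ^ (r - p)) * Real.cos θ
      - p * Real.sin θ) * K h, β + ξ * h ^ (r - 2 * p)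
      + ε * d * (-(2 * p * β * h ^ p + r * ξ * h ^ (r - p)) * Real.sin θ
        + p * Real.cos θ) * K h), by fun_prop, funext fun h => ?_⟩
  have hr' : h ^ r = h ^ (2 * p) * h ^ (r - 2 * p) := by
    rw [← pow_add]
    congr 1
    omega
  simp only [offG2, offX2, offY2, div_eq_mul_inv _ (offSpeed2 p r β ξ h), hKs, Prod.smul_mk,
    Prod.mk_add_mk, smul_eq_mul, hr']
  ext
  · field_simp
    linear_combination -p * h ^ p * hdeg
  · field_simp
    ring

/-- under the degeneracy condition `2εdβ cos θ = 1`, with `p ≥ 2` and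
`2p < r < 3p`, the signature of `G` at `0` is `(p, r − p)`: iterated derivatives of
order `1 ≤ n < p` vanish, `G⁽ᵖ⁾(0) = p!·(0, −2εdβ sin θ) ≠ 0`, `G⁽ᵐ⁾(0) = 0` for
`p < m < r − p`, and `G^{(r−p)}(0)` has nonzero first component
`(r−p)!·(−ε·d·r·ξ·cos θ/p)`, so it is linearly independent from `G⁽ᵖ⁾(0)`. -/
theorem offG2_signature_degenerate_case (p r : ℕ) (hp : 2 ≤ p)
    (hr1 : 2 * p < r) (hr2 : r < 3 * p) (β ξ d θ ε : ℝ)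
    (hξ : ξ ≠ 0) (hd : d ≠ 0) (hθ : Real.sin θ ≠ 0) (hε : ε = 1 ∨ ε = -1)
    (hdeg : 2 * ε * d * β * Real.cos θ = 1) :
    (∀ n : ℕ, 1 ≤ n → n < p → iteratedDeriv n (offG2 p r β ξ d θ ε) 0 = 0) ∧
    iteratedDeriv p (offG2 p r β ξ d θ ε) 0
      = (p.factorial : ℝ) • ((0 : ℝ), -(2 * ε * d * β * Real.sin θ)) ∧
    iteratedDeriv p (offG2 p r β ξ d θ ε) 0 ≠ 0 ∧
    (∀ m : ℕ, p < m → m < r - p → iteratedDeriv m (offG2 p r β ξ d θ ε) 0 = 0) ∧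
    (iteratedDeriv (r - p) (offG2 p r β ξ d θ ε) 0).1
      = ((r - p).factorial : ℝ) * (-(ε * d * (r : ℝ) * ξ * Real.cos θ / (p : ℝ))) ∧
    (iteratedDeriv (r - p) (offG2 p r β ξ d θ ε) 0).1 ≠ 0 ∧
    LinearIndependent ℝ
      ![iteratedDeriv p (offG2 p r β ξ d θ ε) 0,
        iteratedDeriv (r - p) (offG2 p r β ξ d θ ε) 0] := by
  have hpp : 0 < p := by omega
  have hp0 : (p : ℝ) ≠ 0 := by exact_mod_cast hpp.ne'
  have hr0 : (r : ℝ) ≠ 0 := by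
    have : r ≠ 0 := by omega
    exact_mod_cast this
  have hε0 : ε ≠ 0 := by rcases hε with rfl | rfl <;> norm_num
  have hβ : β ≠ 0 := by
    rintro rfl
    simp at hdeg
  have hcos : Real.cos θ ≠ 0 := fun h => by simp [h] at hdeg
  obtain ⟨F, hF, hG⟩ := exists_offG2_eq hpp hr1.le β ξ d θ ε hdeg
  have key : ∀ n : ℕ, 0 < n → n < 2 * p → iteratedDeriv n (offG2 p r β ξ d θ ε) 0 = _ :=
    fun n hn hn' => hG ▸ iteratedDeriv_zero_of_two_term_expansion hF _ _ _ p (r - p) hn hn'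
  have hdp : iteratedDeriv p (offG2 p r β ξ d θ ε) 0
      = (p.factorial : ℝ) • ((0 : ℝ), -(2 * ε * d * β * Real.sin θ)) := by
    rw [key p hpp (by omega), if_pos rfl, if_neg (by omega), add_zero]
  have hdq : (iteratedDeriv (r - p) (offG2 p r β ξ d θ ε) 0).1
      = ((r - p).factorial : ℝ) * (-(ε * d * (r : ℝ) * ξ * Real.cos θ / (p : ℝ))) := by
    rw [key (r - p) (by omega) (by omega), if_neg (by omega), if_pos rfl, zero_add]
    rfl
  have hdp0 : iteratedDeriv p (offG2 p r β ξ d θ ε) 0 ≠ 0 := by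
    rw [hdp]
    simp [Prod.ext_iff, Nat.factorial_ne_zero, hε0, hd, hβ, hθ]
  have hdq0 : (iteratedDeriv (r - p) (offG2 p r β ξ d θ ε) 0).1 ≠ 0 := by
    rw [hdq]
    simp [Nat.factorial_ne_zero, hε0, hd, hr0, hξ, hcos, hp0]
  refine ⟨fun n hn hn' => ?_, hdp, hdp0, fun m hm hm' => ?_, hdq, hdq0, ?_⟩
  · rw [key n (by omega) (by omega), if_neg (by omega), if_neg (by omega), add_zero]
  · rw [key m (by omega) (by omega), if_neg (by omega), if_neg (by omega), add_zero]
  · refine (LinearIndependent.pair_iff' hdp0).2 fun a ha => hdq0 ?_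
    rw [← ha, hdp]
    simp
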